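/- arXiv:1105.3128 — 9 statements merged into one kernel-verified Lean document; each statement's English description precedes it below -/
import Mathlib

section
/- For every dimension m ≥ 1 there exists a sequence of constants C : ℕ → ℝ (with C k ≥ 1, independent of the set and of the parameter) such that: for every nonempty closed set Γ ⊆ ℝ^m and every ε > 0 there exists an infinitely differentiable function φ : ℝ^m → ℝ satisfying (i) φ(x) ≥ ε for all x; (ii) (1/(C 0))·(ε + (infDist(x,Γ))²) ≤ φ(x) ≤ (C 0)·(ε + (infDist(x,Γ))²) for all x; and (iii) for every order k ≥ 1 and every x, the norm of the k-th iterated Fréchet derivative of φ at x is at most (C k)·φ(x)^(1 − k/2). -/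
open MeasureTheory Metric

section VariableScale

variable {E F : Type} [NormedAddCommGroup E] [NormedAddCommGroup F]

theorem rpow_le_of_comparable {A a b : ℝ} (hA : 1 ≤ A) (ha : 0 < a) (hb : 0 < b)
    (hab : a ≤ A * b) (hba : b ≤ A * a) (p : ℝ) : a ^ p ≤ A ^ |p| * b ^ p := by
  have hA0 : 0 < A := by linarith
  rcases le_total 0 p with hp | hp
  · rw [abs_of_nonneg hp, ← Real.mul_rpow hA0.le hb.le]
    exact Real.rpow_le_rpow ha.le hab hp
  · rw [abs_of_nonpos hp]
    have h : a ^ p ≤ (A⁻¹ * b) ^ p :=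
      Real.rpow_le_rpow_of_nonpos (by positivity) (by rwa [inv_mul_le_iff₀ hA0]) hp
    rwa [Real.mul_rpow (by positivity) hb.le, Real.inv_rpow hA0.le, ← Real.rpow_neg hA0.le] at h

theorem exists_norm_le_of_tsupport_subset [NormedSpace ℝ E] [FiniteDimensional ℝ E]
    {η : E → F} (hη : Continuous η) (hs : tsupport η ⊆ closedBall 0 (1 / 2)) :
    ∃ B, ∀ z, ‖η z‖ ≤ B :=
  have := FiniteDimensional.proper_real E
  HasCompactSupport.exists_bound_of_continuous
    ((isCompact_closedBall 0 (1 / 2)).of_isClosed_subset (isClosed_tsupport η) hs) hη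

/-- A positive `1`-Lipschitz function, used as a length scale varying from point to point. -/
structure IsScale (r : E → ℝ) : Prop where
  pos : ∀ x, 0 < r x
  lipschitz : LipschitzWith 1 r

theorem isScale_sqrt_add_infDist_sq (Γ : Set E) {ε : ℝ} (hε : 0 < ε) :
    IsScale fun x => √(ε + infDist x Γ ^ 2) where
  pos x := by positivity
  lipschitz := LipschitzWith.of_le_add fun x y => by
    have h : infDist x Γ ≤ infDist y Γ + dist x y := infDist_le_infDist_add_dist
    have hs : infDist y Γ ≤ √(ε + infDist y Γ ^ 2) := Real.le_sqrt_of_sq_le (by linarith)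
    have hsq : √(ε + infDist y Γ ^ 2) ^ 2 = ε + infDist y Γ ^ 2 := Real.sq_sqrt (by positivity)
    refine Real.sqrt_le_iff.2 ⟨by positivity, ?_⟩
    nlinarith [infDist_nonneg (x := x) (s := Γ), pow_le_pow_left₀ infDist_nonneg h 2,
      mul_le_mul_of_nonneg_right hs (dist_nonneg (x := x) (y := y))]

namespace IsScale

variable {r : E → ℝ}

theorem le_add (hr : IsScale r) (x y : E) : r x ≤ r y + ‖x - y‖ := by
  have h := hr.lipschitz.dist_le_mul x y
  rw [Real.dist_eq, dist_eq_norm, NNReal.coe_one, one_mul] at h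
  linarith [le_abs_self (r x - r y)]

theorem continuous_rpow (hr : IsScale r) (p : ℝ) : Continuous fun y => r y ^ p :=
  hr.lipschitz.continuous.rpow_const fun y => Or.inl (hr.pos y).ne'

theorem comparable (hr : IsScale r) {x y : E} (h : ‖x - y‖ ≤ r y / 2) :
    r x ≤ 2 * r y ∧ r y ≤ 2 * r x := by
  have h1 := hr.le_add x y
  have h2 := hr.le_add y x
  have := hr.pos y
  rw [norm_sub_rev] at h2
  constructor <;> linarith

variable [NormedSpace ℝ E]

theorem norm_sub_le (hr : IsScale r) {η : E → F} (hs : tsupport η ⊆ closedBall 0 (1 / 2))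
    {x y : E} (h : η ((r y)⁻¹ • (x - y)) ≠ 0) : ‖x - y‖ ≤ r y / 2 := by
  have h1 := hs (subset_tsupport η h)
  rw [mem_closedBall_zero_iff, norm_smul, norm_inv, Real.norm_of_nonneg (hr.pos y).le,
    inv_mul_le_iff₀ (hr.pos y)] at h1
  linarith

variable [NormedSpace ℝ F]

theorem continuous_profile (hr : IsScale r) {η : E → F} (hη : Continuous η) (p : ℝ) (x : E) :
    Continuous fun y => r y ^ p • η ((r y)⁻¹ • (x - y)) :=
  (hr.continuous_rpow p).smul (hη.comp
    ((hr.lipschitz.continuous.inv₀ fun y => (hr.pos y).ne').smul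
      (continuous_const.sub continuous_id)))

theorem norm_profile_le (hr : IsScale r) {η : E → F} (hs : tsupport η ⊆ closedBall 0 (1 / 2))
    {B : ℝ} (hB : ∀ z, ‖η z‖ ≤ B) (p : ℝ) {x x₀ : E} {R : ℝ} (hR : r x + ‖x - x₀‖ ≤ R) (y : E) :
    ‖r y ^ p • η ((r y)⁻¹ • (x - y))‖ ≤ (closedBall x₀ R).indicator (fun y => B * r y ^ p) y := by
  have hB0 : 0 ≤ B := (norm_nonneg _).trans (hB 0)
  have hp : 0 ≤ r y ^ p := (Real.rpow_pos_of_pos (hr.pos y) p).le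
  by_cases h : η ((r y)⁻¹ • (x - y)) = 0
  · rw [h, smul_zero, norm_zero]
    exact Set.indicator_nonneg (fun y _ => mul_nonneg hB0 (Real.rpow_pos_of_pos (hr.pos y) p).le) y
  · have h1 := hr.norm_sub_le hs h
    have h2 := hr.le_add y x
    rw [norm_sub_rev] at h2
    have h3 : y ∈ closedBall x₀ R := by
      rw [mem_closedBall, dist_eq_norm]
      have := norm_sub_le_norm_sub_add_norm_sub y x x₀
      rw [norm_sub_rev y x] at this
      linarith
    rw [Set.indicator_of_mem h3, norm_smul, Real.norm_of_nonneg hp, mul_comm]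
    exact mul_le_mul_of_nonneg_right (hB _) hp

variable [MeasurableSpace E] [BorelSpace E] [FiniteDimensional ℝ E]
  (μ : Measure E) [μ.IsAddHaarMeasure]

/-- The superposition of copies of `η` centred at `y`, dilated by `r y` and weighted by `r y ^ p`. -/
noncomputable def _root_.scaledAverage (r : E → ℝ) (η : E → F) (p : ℝ) (x : E) : F :=
  ∫ y, r y ^ p • η ((r y)⁻¹ • (x - y)) ∂μ

theorem integrable_indicator (hr : IsScale r) (B p : ℝ) (x : E) (R : ℝ) :
    Integrable ((closedBall x R).indicator fun y => B * r y ^ p) μ :=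
  have := FiniteDimensional.proper_real E
  (((hr.continuous_rpow p).const_mul B).continuousOn.integrableOn_compact
    (isCompact_closedBall x R)).integrable_indicator measurableSet_closedBall

theorem integrable_profile (hr : IsScale r) {η : E → F} (hη : Continuous η)
    (hs : tsupport η ⊆ closedBall 0 (1 / 2)) (p : ℝ) (x : E) :
    Integrable (fun y => r y ^ p • η ((r y)⁻¹ • (x - y))) μ := by
  obtain ⟨B, hB⟩ := exists_norm_le_of_tsupport_subset hη hs
  exact (hr.integrable_indicator μ B p x (r x)).mono'
    (hr.continuous_profile hη p x).aestronglyMeasurable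
    (ae_of_all _ (hr.norm_profile_le hs hB p (by simp)))

theorem hasFDerivAt_scaledAverage (hr : IsScale r) {η : E → F} (hη : ContDiff ℝ 1 η)
    (hs : tsupport η ⊆ closedBall 0 (1 / 2)) (p : ℝ) (x₀ : E) :
    HasFDerivAt (scaledAverage μ r η p) (scaledAverage μ r (fderiv ℝ η) (p - 1) x₀) x₀ := by
  have hη' : Continuous (fderiv ℝ η) := hη.continuous_fderiv one_ne_zero
  have hs' := (tsupport_fderiv_subset ℝ (f := η)).trans hs
  obtain ⟨B, hB⟩ := exists_norm_le_of_tsupport_subset hη' hs'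
  refine hasFDerivAt_integral_of_dominated_of_fderiv_le
    (F' := fun x y => r y ^ (p - 1) • fderiv ℝ η ((r y)⁻¹ • (x - y)))
    (ball_mem_nhds x₀ one_pos)
    (Filter.Eventually.of_forall fun x =>
      (hr.continuous_profile hη.continuous p x).aestronglyMeasurable)
    (hr.integrable_profile μ hη.continuous hs p x₀)
    (hr.continuous_profile hη' (p - 1) x₀).aestronglyMeasurable
    (ae_of_all _ fun y x hx => hr.norm_profile_le hs' hB (p - 1) (R := r x₀ + 2) ?_ y)
    (hr.integrable_indicator μ B (p - 1) x₀ (r x₀ + 2))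
    (ae_of_all _ fun y x _ => ?_)
  · rw [mem_ball, dist_eq_norm] at hx
    linarith [hr.le_add x x₀]
  · have h1 : HasFDerivAt (fun x => (r y)⁻¹ • (x - y)) ((r y)⁻¹ • ContinuousLinearMap.id ℝ E) x :=
      ((hasFDerivAt_id x).sub_const y).const_smul _
    have h2 := ((hη.differentiable one_ne_zero _).hasFDerivAt.comp x h1).const_smul (r y ^ p)
    refine h2.congr_fderiv ?_
    rw [ContinuousLinearMap.comp_smul, ContinuousLinearMap.comp_id, smul_smul,
      Real.rpow_sub_one (hr.pos y).ne', div_eq_mul_inv]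

theorem contDiff_scaledAverage (hr : IsScale r) (n : ℕ) {F : Type} [NormedAddCommGroup F]
    [NormedSpace ℝ F] {η : E → F} (hη : ContDiff ℝ (⊤ : ℕ∞) η)
    (hs : tsupport η ⊆ closedBall 0 (1 / 2)) (p : ℝ) :
    ContDiff ℝ n (scaledAverage μ r η p) := by
  have hd {F : Type} [NormedAddCommGroup F] [NormedSpace ℝ F] {η : E → F}
      (hη : ContDiff ℝ (⊤ : ℕ∞) η) (hs : tsupport η ⊆ closedBall 0 (1 / 2)) (p : ℝ) :=
    hr.hasFDerivAt_scaledAverage μ (hη.of_le (by exact_mod_cast le_top)) hs p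
  induction n generalizing F p with
  | zero =>
    exact contDiff_zero.2 (continuous_iff_continuousAt.2 fun x => (hd hη hs p x).continuousAt)
  | succ n ih =>
    refine contDiff_succ_iff_hasFDerivAt.2 ⟨_, ih (hη.fderiv_right (m := (⊤ : ℕ∞)) le_rfl)
      ((tsupport_fderiv_subset ℝ).trans hs) (p - 1), hd hη hs p⟩

theorem measureReal_closedBall_scale (hr : IsScale r) (x : E) {t : ℝ} (ht : 0 ≤ t) :
    μ.real (closedBall x (t * r x)) =
      t ^ Module.finrank ℝ E * r x ^ Module.finrank ℝ E * μ.real (ball 0 1) := by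
  rw [Measure.addHaar_real_closedBall _ _ (mul_nonneg ht (hr.pos x).le), mul_pow]

theorem _root_.exists_norm_scaledAverage_le {η : E → F} (hη : Continuous η)
    (hs : tsupport η ⊆ closedBall 0 (1 / 2)) (p : ℝ) :
    ∃ C : ℝ, 0 ≤ C ∧ ∀ r : E → ℝ, IsScale r → ∀ x,
      ‖scaledAverage μ r η p x‖ ≤ C * r x ^ (p + Module.finrank ℝ E) := by
  obtain ⟨B, hB⟩ := exists_norm_le_of_tsupport_subset hη hs
  have hB0 : 0 ≤ B := (norm_nonneg _).trans (hB 0)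
  refine ⟨B * 2 ^ |p| * μ.real (ball 0 1), by positivity, fun r hr x => ?_⟩
  have := FiniteDimensional.proper_real E
  have key : ∀ y, ‖r y ^ p • η ((r y)⁻¹ • (x - y))‖ ≤
      (closedBall x (1 * r x)).indicator (fun _ => B * (2 ^ |p| * r x ^ p)) y := fun y => by
    by_cases h : η ((r y)⁻¹ • (x - y)) = 0
    · rw [h, smul_zero, norm_zero]
      have := (hr.pos x).le
      exact Set.indicator_nonneg (fun _ _ => by positivity) y
    · refine (hr.norm_profile_le hs hB p (x₀ := x) (R := 1 * r x) (by simp) y).trans ?_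
      obtain ⟨h1, h2⟩ := hr.comparable (hr.norm_sub_le hs h)
      refine Set.indicator_le_indicator ?_
      exact mul_le_mul_of_nonneg_left
        (rpow_le_of_comparable one_le_two (hr.pos y) (hr.pos x) h2 h1 p) hB0
  have hint : Integrable
      ((closedBall x (1 * r x)).indicator fun _ => B * (2 ^ |p| * r x ^ p)) μ :=
    (continuousOn_const.integrableOn_compact
      (isCompact_closedBall x _)).integrable_indicator measurableSet_closedBall
  refine (norm_integral_le_of_norm_le hint (ae_of_all _ key)).trans_eq ?_
  rw [integral_indicator_const _ measurableSet_closedBall,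
    hr.measureReal_closedBall_scale μ x zero_le_one, smul_eq_mul, Real.rpow_add (hr.pos x),
    Real.rpow_natCast]
  ring

theorem _root_.exists_norm_iteratedFDeriv_scaledAverage_le (k : ℕ) {F : Type}
    [NormedAddCommGroup F] [NormedSpace ℝ F] {η : E → F} (hη : ContDiff ℝ (⊤ : ℕ∞) η)
    (hs : tsupport η ⊆ closedBall 0 (1 / 2)) (p : ℝ) :
    ∃ C : ℝ, 0 ≤ C ∧ ∀ r : E → ℝ, IsScale r → ∀ x,
      ‖iteratedFDeriv ℝ k (scaledAverage μ r η p) x‖ ≤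
        C * r x ^ (p + Module.finrank ℝ E - k) := by
  induction k generalizing F p with
  | zero => simpa using exists_norm_scaledAverage_le μ hη.continuous hs p
  | succ k ih =>
    obtain ⟨C, hC0, hC⟩ := ih (hη.fderiv_right (m := (⊤ : ℕ∞)) le_rfl)
      ((tsupport_fderiv_subset ℝ).trans hs) (p - 1)
    refine ⟨C, hC0, fun r hr x => ?_⟩
    have hd : fderiv ℝ (scaledAverage μ r η p) = scaledAverage μ r (fderiv ℝ η) (p - 1) :=
      funext fun x => (hr.hasFDerivAt_scaledAverage μ
        (hη.of_le (by exact_mod_cast le_top)) hs p x).fderiv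
    rw [← norm_iteratedFDeriv_fderiv, hd]
    refine (hC r hr x).trans_eq ?_
    push_cast
    ring_nf

theorem _root_.exists_le_scaledAverage {η : E → ℝ} (hη : Continuous η)
    (hs : tsupport η ⊆ closedBall 0 (1 / 2)) (h0 : ∀ z, 0 ≤ η z)
    (h1 : ∀ z ∈ closedBall (0 : E) (1 / 4), η z = 1) (p : ℝ) :
    ∃ c : ℝ, 0 < c ∧ ∀ r : E → ℝ, IsScale r → ∀ x,
      c * r x ^ (p + Module.finrank ℝ E) ≤ scaledAverage μ r η p x := by
  have hμ : 0 < μ.real (ball (0 : E) 1) := by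
    rw [measureReal_def]
    exact ENNReal.toReal_pos (measure_ball_pos μ 0 one_pos).ne' measure_ball_lt_top.ne
  refine ⟨(2 ^ |p|)⁻¹ * (1 / 8) ^ Module.finrank ℝ E * μ.real (ball 0 1), by positivity,
    fun r hr x => ?_⟩
  have hx := hr.pos x
  have := FiniteDimensional.proper_real E
  have key : ∀ y, (closedBall x (1 / 8 * r x)).indicator (fun _ => (2 ^ |p|)⁻¹ * r x ^ p) y ≤
      r y ^ p • η ((r y)⁻¹ • (x - y)) := fun y => by
    have hy := hr.pos y
    by_cases h : y ∈ closedBall x (1 / 8 * r x)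
    · rw [Set.indicator_of_mem h]
      rw [mem_closedBall, dist_eq_norm, norm_sub_rev] at h
      have hxy := hr.le_add x y
      have hη1 : η ((r y)⁻¹ • (x - y)) = 1 := h1 _ <| by
        rw [mem_closedBall_zero_iff, norm_smul, norm_inv, Real.norm_of_nonneg hy.le,
          inv_mul_le_iff₀ hy]
        linarith
      obtain ⟨h2, h3⟩ := hr.comparable (x := x) (y := y) (by linarith)
      rw [hη1, smul_eq_mul, mul_one, inv_mul_le_iff₀ (by positivity)]
      exact rpow_le_of_comparable one_le_two hx hy h2 h3 p
    · rw [Set.indicator_of_notMem h, smul_eq_mul]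
      exact mul_nonneg (by positivity) (h0 _)
  have hint : Integrable
      ((closedBall x (1 / 8 * r x)).indicator fun _ => (2 ^ |p|)⁻¹ * r x ^ p) μ :=
    (continuousOn_const.integrableOn_compact
      (isCompact_closedBall x _)).integrable_indicator measurableSet_closedBall
  refine le_trans (le_of_eq ?_) (integral_mono hint (hr.integrable_profile μ hη hs p x) key)
  rw [integral_indicator_const _ measurableSet_closedBall,
    hr.measureReal_closedBall_scale μ x (by norm_num), smul_eq_mul, Real.rpow_add hx,
    Real.rpow_natCast]
  ring

end IsScale

end VariableScale


/-- Regularized squared-distance function (Lemma 3.2 of the paper): for every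
dimension `m ≥ 1` there are constants `C k ≥ 1`, independent of the closed set `Γ`
and of `ε`, such that for every nonempty closed `Γ ⊆ ℝ^m` and every `ε > 0` there is
a smooth `φ` with `φ ≥ ε`, `φ ∼ ε + dist(·,Γ)²`, and
`‖D^k φ‖ ≤ C k · φ^(1 - k/2)` for every `k ≥ 1`. -/
theorem whitney_regularized_distance (m : ℕ) (hm : 1 ≤ m) :
    ∃ C : ℕ → ℝ, (∀ k, 1 ≤ C k) ∧
      ∀ Γ : Set (EuclideanSpace ℝ (Fin m)), Γ.Nonempty → IsClosed Γ →
        ∀ ε : ℝ, 0 < ε →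
          ∃ φ : EuclideanSpace ℝ (Fin m) → ℝ,
            ContDiff ℝ (⊤ : ℕ∞) φ ∧
            (∀ x, ε ≤ φ x) ∧
            (∀ x, (1 / C 0) * (ε + Metric.infDist x Γ ^ 2) ≤ φ x ∧
              φ x ≤ C 0 * (ε + Metric.infDist x Γ ^ 2)) ∧
            (∀ k : ℕ, 1 ≤ k → ∀ x,
              ‖iteratedFDeriv ℝ k φ x‖ ≤ C k * φ x ^ ((1 : ℝ) - (k : ℝ) / 2)) := by
  let E := EuclideanSpace ℝ (Fin m)
  let b : ContDiffBump (0 : E) := ⟨1 / 4, 1 / 2, by norm_num, by norm_num⟩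
  have hb : ContDiff ℝ (⊤ : ℕ∞) b := b.contDiff
  have hs : tsupport b ⊆ closedBall 0 (1 / 2) := b.tsupport_eq.le
  have hdim : (2 - m + Module.finrank ℝ E : ℝ) = 2 := by simp [E]
  obtain ⟨c, hc, hlow⟩ := exists_le_scaledAverage (volume : Measure E) b.continuous hs
    (fun _ => b.nonneg) (fun _ => b.one_of_mem_closedBall) (2 - m)
  choose D hD0 hD using fun k =>
    exists_norm_iteratedFDeriv_scaledAverage_le (volume : Measure E) k hb hs (2 - m)
  simp only [hdim] at hlow hD
  set A : ℝ := max 1 (c⁻¹ * D 0)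
  have hA : 1 ≤ A := le_max_left _ _
  refine ⟨fun k => if k = 0 then A else max 1 (c⁻¹ * D k * A ^ |(1 : ℝ) - k / 2|), fun k => ?_,
    fun Γ _ _ ε hε => ?_⟩
  · dsimp only
    split_ifs
    exacts [hA, le_max_left _ _]
  set r : E → ℝ := fun x => √(ε + infDist x Γ ^ 2)
  have hr : IsScale r := isScale_sqrt_add_infDist_sq Γ hε
  have hsq : ∀ x, r x ^ 2 = ε + infDist x Γ ^ 2 := fun x => Real.sq_sqrt (by positivity)
  set I : E → ℝ := scaledAverage volume r b (2 - m)
  have hI : ContDiff ℝ (⊤ : ℕ∞) I :=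
    contDiff_infty.2 fun n => hr.contDiff_scaledAverage volume n hb hs (2 - m)
  have hφlow : ∀ x, r x ^ 2 ≤ c⁻¹ * I x := fun x => by
    rw [le_inv_mul_iff₀ hc, ← Real.rpow_two]
    exact hlow r hr x
  have hφup : ∀ x, c⁻¹ * I x ≤ A * r x ^ 2 := fun x => by
    have h := hD 0 r hr x
    rw [norm_iteratedFDeriv_zero, Nat.cast_zero, sub_zero, Real.rpow_two] at h
    calc c⁻¹ * I x ≤ c⁻¹ * (D 0 * r x ^ 2) := by gcongr; exact (le_abs_self _).trans h
      _ = c⁻¹ * D 0 * r x ^ 2 := by ring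
      _ ≤ A * r x ^ 2 := by gcongr; exact le_max_right _ _
  refine ⟨fun x => c⁻¹ * I x, contDiff_const.mul hI, fun x => ?_, fun x => ?_, fun k hk x => ?_⟩
  · nlinarith [hφlow x, hsq x, sq_nonneg (infDist x Γ)]
  · simp only [if_true]
    rw [← hsq]
    refine ⟨le_trans ?_ (hφlow x), hφup x⟩
    rw [one_div, inv_mul_le_iff₀ (by linarith)]
    exact le_mul_of_one_le_left (sq_nonneg _) hA
  · simp only [if_neg (Nat.one_le_iff_ne_zero.1 hk)]
    have hrx := hr.pos x
    have hrx2 : 0 < r x ^ 2 := by positivity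
    have hφ : 0 < c⁻¹ * I x := hrx2.trans_le (hφlow x)
    have hderiv : ‖iteratedFDeriv ℝ k (fun x => c⁻¹ * I x) x‖ =
        c⁻¹ * ‖iteratedFDeriv ℝ k I x‖ := by
      have h : iteratedFDeriv ℝ k (fun x => c⁻¹ * I x) x = c⁻¹ • iteratedFDeriv ℝ k I x :=
        iteratedFDeriv_const_smul_apply (a := c⁻¹) (hI.of_le (by exact_mod_cast le_top)).contDiffAt
      rw [h, norm_smul, Real.norm_of_nonneg (by positivity)]
    have hpow : r x ^ ((2 : ℝ) - k) = (r x ^ 2) ^ ((1 : ℝ) - k / 2) := by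
      rw [← Real.rpow_natCast (r x) 2, ← Real.rpow_mul hrx.le]
      congr 1
      push_cast
      ring
    rw [hderiv]
    calc c⁻¹ * ‖iteratedFDeriv ℝ k I x‖ ≤ c⁻¹ * (D k * r x ^ ((2 : ℝ) - k)) := by
          gcongr
          exact hD k r hr x
      _ ≤ c⁻¹ * (D k * (A ^ |(1 : ℝ) - k / 2| * (c⁻¹ * I x) ^ ((1 : ℝ) - k / 2))) := by
          rw [hpow]
          have := hD0 k
          gcongr
          refine rpow_le_of_comparable hA hrx2 hφ ?_ (hφup x) _
          exact (hφlow x).trans (le_mul_of_one_le_left hφ.le hA)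
      _ = c⁻¹ * D k * A ^ |(1 : ℝ) - k / 2| * (c⁻¹ * I x) ^ ((1 : ℝ) - k / 2) := by ring
      _ ≤ _ := by
          gcongr
          exact le_max_right _ _
end

section
/- Let Γ ⊆ ℝ^m be a nonempty closed set, let 0 < δ < 1/9, and let (x_j)_{j∈J} be a family of points of ℝ^m ∖ Γ such that dist(x_j, x_i) ≥ δ·infDist(x_i, Γ) for all i ≠ j, which is maximal in the following sense: for every x ∈ ℝ^m ∖ Γ that is not one of the points x_j, there exists an index j with dist(x, x_j) < δ·infDist(x_j, Γ) or dist(x, x_j) < δ·infDist(x, Γ). Then the open balls B(x_j, infDist(x_j,Γ)/8) cover ℝ^m ∖ Γ: for every x ∈ ℝ^m ∖ Γ there exists j with dist(x, x_j) < infDist(x_j, Γ)/8. -/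
/-- Whitney covering claim (eq. (18) in the proof of Lemma 3.2 of the paper):
if `(x j)` is a `δ`-separated family in `ℝ^m ∖ Γ` (with `0 < δ < 1/9`) which is
maximal, then the balls `B(x j, infDist(x j, Γ)/8)` cover `ℝ^m ∖ Γ`. -/
theorem whitney_balls_cover (m : ℕ) (Γ : Set (EuclideanSpace ℝ (Fin m)))
    (hΓne : Γ.Nonempty) (hΓcl : IsClosed Γ)
    (δ : ℝ) (hδ0 : 0 < δ) (hδ1 : δ < 1 / 9)
    (J : Type*) (x : J → EuclideanSpace ℝ (Fin m))
    (hxΓ : ∀ j, x j ∉ Γ)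
    (hsep : ∀ i j : J, i ≠ j → δ * Metric.infDist (x i) Γ ≤ dist (x j) (x i))
    (hmax : ∀ y : EuclideanSpace ℝ (Fin m), y ∉ Γ → (∀ j, y ≠ x j) →
      ∃ j, dist y (x j) < δ * Metric.infDist (x j) Γ ∨
        dist y (x j) < δ * Metric.infDist y Γ) :
    ∀ y : EuclideanSpace ℝ (Fin m), y ∉ Γ →
      ∃ j, dist y (x j) < Metric.infDist (x j) Γ / 8 := by
  intro y hy
  have hpos : ∀ z, z ∉ Γ → 0 < Metric.infDist z Γ := fun z hz =>
    (hΓcl.notMem_iff_infDist_pos hΓne).1 hz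
  by_cases hyx : ∀ j, y ≠ x j
  · obtain ⟨j, hj⟩ := hmax y hy hyx
    refine ⟨j, ?_⟩
    rcases hj with hj | hj
    · nlinarith [hpos (x j) (hxΓ j)]
    · have htri : Metric.infDist y Γ ≤ Metric.infDist (x j) Γ + dist y (x j) :=
        Metric.infDist_le_infDist_add_dist
      have hmul := mul_lt_mul_of_pos_right hδ1 (hpos y hy)
      linarith
  · push Not at hyx
    obtain ⟨j, rfl⟩ := hyx
    exact ⟨j, by simpa using hpos (x j) (hxΓ j)⟩
end

section
/- Let Γ ⊆ ℝ^m be a nonempty closed set, let 0 < δ ≤ 1, and let S ⊆ ℝ^m ∖ Γ be a set of points such that dist(y, z) ≥ δ·infDist(z, Γ) for all y, z ∈ S with y ≠ z. Then for every x ∈ ℝ^m ∖ Γ, the set { y ∈ S : dist(x, y) ≤ infDist(y, Γ)/2 } is finite and has at most (4/δ)^m elements. -/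
open MeasureTheory Metric Module in
/-- Volume packing bound: a finite `2r`-separated subset of a closed ball of radius `R` has at most
`((R + r) / r) ^ dim E` elements. -/
theorem Finset.card_le_of_separated_of_subset_closedBall {E : Type*} [NormedAddCommGroup E]
    [NormedSpace ℝ E] [FiniteDimensional ℝ E] (s : Finset E) (x : E) {r R : ℝ} (hr : 0 < r)
    (hR : 0 ≤ R) (hs : ∀ y ∈ s, dist y x ≤ R)
    (hsep : ∀ y ∈ s, ∀ z ∈ s, y ≠ z → 2 * r ≤ dist y z) :
    (s.card : ℝ) ≤ ((R + r) / r) ^ finrank ℝ E := by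
  borelize E
  let μ : Measure E := Measure.addHaar
  have hdisj : (s : Set E).PairwiseDisjoint fun y => ball y r := by
    intro y hy z hz hyz
    exact ball_disjoint_ball (by linarith [hsep y hy z hz hyz])
  have hsub : (⋃ y ∈ s, ball y r) ⊆ ball x (R + r) := by
    refine Set.iUnion₂_subset fun y hy => ball_subset_ball' ?_
    linarith [hs y hy]
  have hvol : (s.card : ENNReal) * (ENNReal.ofReal (r ^ finrank ℝ E) * μ (ball 0 1)) ≤
      ENNReal.ofReal ((R + r) ^ finrank ℝ E) * μ (ball 0 1) :=
    calc
      _ = ∑ y ∈ s, μ (ball y r) := by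
        simp [μ.addHaar_ball_of_pos _ hr]
      _ = μ (⋃ y ∈ s, ball y r) :=
        (measure_biUnion_finset hdisj fun _ _ => measurableSet_ball).symm
      _ ≤ μ (ball x (R + r)) := measure_mono hsub
      _ = _ := μ.addHaar_ball_of_pos x (by positivity)
  rw [← mul_assoc, ENNReal.mul_le_mul_iff_left (measure_ball_pos μ _ zero_lt_one).ne'
    measure_ball_lt_top.ne, ← ENNReal.ofReal_natCast, ← ENNReal.ofReal_mul (by positivity),
    ENNReal.ofReal_le_ofReal_iff (by positivity)] at hvol
  rwa [div_pow, le_div_iff₀ (by positivity)]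

/-- A set all of whose finite subsets have at most `C` elements is finite with at most `C`
elements. -/
theorem Set.finite_and_ncard_le_of_forall_finset_card_le {α : Type*} {T : Set α} {C : ℝ}
    (h : ∀ s : Finset α, (s : Set α) ⊆ T → (s.card : ℝ) ≤ C) :
    T.Finite ∧ (T.ncard : ℝ) ≤ C := by
  have hfin : T.Finite := by
    by_contra hinf
    obtain ⟨n, hn⟩ := exists_nat_gt C
    obtain ⟨s, hsT, hcard⟩ := Set.Infinite.exists_subset_card_eq hinf n
    have := h s hsT
    rw [hcard] at this
    linarith
  refine ⟨hfin, ?_⟩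
  rw [Set.ncard_eq_toFinset_card T hfin]
  exact h _ (by simp)

/-- Bounded multiplicity of the Whitney covering (proof of Lemma 3.2 of the paper):
if `S ⊆ ℝ^m ∖ Γ` is `δ`-separated (relative to the distance to `Γ`), with
`0 < δ ≤ 1`, then for every `x ∉ Γ` the set of `y ∈ S` with
`dist(x,y) ≤ infDist(y,Γ)/2` is finite with at most `(4/δ)^m` elements. -/
theorem whitney_bounded_multiplicity (m : ℕ) (Γ : Set (EuclideanSpace ℝ (Fin m)))
    (hΓne : Γ.Nonempty) (hΓcl : IsClosed Γ)
    (δ : ℝ) (hδ0 : 0 < δ) (hδ1 : δ ≤ 1)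
    (S : Set (EuclideanSpace ℝ (Fin m)))
    (hSΓ : ∀ y ∈ S, y ∉ Γ)
    (hsep : ∀ y ∈ S, ∀ z ∈ S, y ≠ z → δ * Metric.infDist z Γ ≤ dist y z)
    (x : EuclideanSpace ℝ (Fin m)) (hx : x ∉ Γ) :
    {y ∈ S | dist x y ≤ Metric.infDist y Γ / 2}.Finite ∧
      ({y ∈ S | dist x y ≤ Metric.infDist y Γ / 2}.ncard : ℝ) ≤ (4 / δ) ^ m := by
  have hd : 0 < Metric.infDist x Γ := (hΓcl.notMem_iff_infDist_pos hΓne).1 hx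
  refine Set.finite_and_ncard_le_of_forall_finset_card_le fun s hs => ?_
  have hr : 0 < δ * Metric.infDist x Γ / 3 := by positivity
  have hcard := s.card_le_of_separated_of_subset_closedBall x hr hd.le
    (fun y hy => by
      have hy' := (hs hy).2
      have := Metric.infDist_le_infDist_add_dist (s := Γ) (x := y) (y := x)
      rw [dist_comm y x] at this ⊢
      linarith)
    (fun y hy z hz hyz => by
      have hz' := (hs hz).2
      have := Metric.infDist_le_infDist_add_dist (s := Γ) (x := x) (y := z)
      have hxz : 2 / 3 * Metric.infDist x Γ ≤ Metric.infDist z Γ := by linarith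
      have := mul_le_mul_of_nonneg_left hxz hδ0.le
      linarith [hsep y (hs hy).1 z (hs hz).1 hyz])
  rw [finrank_euclideanSpace_fin] at hcard
  refine hcard.trans (pow_le_pow_left₀ (by positivity) ?_ m)
  rw [div_le_div_iff₀ hr hδ0]
  nlinarith [mul_le_mul_of_nonneg_right hδ1 (mul_pos hδ0 hd).le]
end

section
/- Let (X,d) be a metric space, T ⊆ X a nonempty subset, F : X → X a map, ε > 0, C ≥ 1, θ ∈ (0,1), and K ∈ ℕ with C⁴·θ^(2(K+1)) ≤ 1/2. Let φ : X → ℝ satisfy (1/C)·(ε + infDist(ρ,T)²) ≤ φ(ρ) ≤ C·(ε + infDist(ρ,T)²) for all ρ ∈ X. Let V ⊆ X be a set such that infDist(F^[k](ρ), T) ≤ C·θ^k·infDist(ρ,T) for all ρ ∈ V and all 0 ≤ k ≤ K+1, where F^[k] is the k-fold iterate of F. Define φ̂(ρ) := Σ_{k=0}^{K} φ(F^[k](ρ)). Then for every ρ ∈ V: (i) (1/C)·(ε + infDist(ρ,T)²) ≤ φ̂(ρ) ≤ (K+1)·C·(1+C²)·(ε + infDist(ρ,T)²); and (ii) φ̂(ρ)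 − φ̂(F(ρ)) + C·ε ≥ φ̂(ρ)/(2·C²·(K+1)·(1+C²)). -/
open Metric Finset

/-- Analytic core of Lemma 4.1 of the paper: summing a regularized squared-distance
function `φ` along a forward orbit contracting toward `T` at rate `θ` produces
`φ̂(ρ) = Σ_{k=0}^{K} φ(F^[k] ρ)` comparable to `ε + infDist(·,T)²`, which decreases
by a definite proportion, up to `O(ε)`, under one step of the map. -/
theorem escape_sum_along_orbit
    {X : Type*} [MetricSpace X] (T : Set X) (hT : T.Nonempty)
    (F : X → X) (ε : ℝ) (hε : 0 < ε) (C : ℝ) (hC : 1 ≤ C)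
    (θ : ℝ) (hθ0 : 0 < θ) (hθ1 : θ < 1) (K : ℕ)
    (hK : C ^ 4 * θ ^ (2 * (K + 1)) ≤ 1 / 2)
    (φ : X → ℝ)
    (hφ : ∀ ρ : X, (1 / C) * (ε + infDist ρ T ^ 2) ≤ φ ρ ∧
      φ ρ ≤ C * (ε + infDist ρ T ^ 2))
    (V : Set X)
    (hcontr : ∀ ρ ∈ V, ∀ k : ℕ, k ≤ K + 1 →
      infDist (F^[k] ρ) T ≤ C * θ ^ k * infDist ρ T) :
    ∀ ρ ∈ V,
      ((1 / C) * (ε + infDist ρ T ^ 2) ≤ ∑ k ∈ range (K + 1), φ (F^[k] ρ) ∧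
        ∑ k ∈ range (K + 1), φ (F^[k] ρ) ≤
          (K + 1 : ℝ) * C * (1 + C ^ 2) * (ε + infDist ρ T ^ 2)) ∧
      (∑ k ∈ range (K + 1), φ (F^[k] ρ)) - (∑ k ∈ range (K + 1), φ (F^[k] (F ρ)))
          + C * ε ≥
        (∑ k ∈ range (K + 1), φ (F^[k] ρ)) / (2 * C ^ 2 * (K + 1 : ℝ) * (1 + C ^ 2)) := by
  intro ρ hρ
  have hC0 : 0 < C := by linarith
  have hφ0 (x : X) : 0 ≤ φ x := le_trans (by positivity) (hφ x).1
  have hsq (k : ℕ) (hk : k ≤ K + 1) :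
      infDist (F^[k] ρ) T ^ 2 ≤ C ^ 2 * θ ^ (2 * k) * infDist ρ T ^ 2 :=
    calc infDist (F^[k] ρ) T ^ 2 ≤ (C * θ ^ k * infDist ρ T) ^ 2 :=
          pow_le_pow_left₀ infDist_nonneg (hcontr ρ hρ k hk) 2
      _ = C ^ 2 * θ ^ (2 * k) * infDist ρ T ^ 2 := by ring
  have hD : 0 ≤ infDist ρ T ^ 2 := sq_nonneg _
  have hlower : (1 / C) * (ε + infDist ρ T ^ 2) ≤ ∑ k ∈ range (K + 1), φ (F^[k] ρ) :=
    (hφ ρ).1.trans <| single_le_sum (f := fun k => φ (F^[k] ρ)) (fun k _ => hφ0 _)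
      (mem_range.2 K.succ_pos)
  have hterm (k : ℕ) (hk : k ∈ range (K + 1)) :
      φ (F^[k] ρ) ≤ C * (1 + C ^ 2) * (ε + infDist ρ T ^ 2) := by
    have hθk : θ ^ (2 * k) ≤ 1 := pow_le_one₀ hθ0.le hθ1.le
    have hdist : infDist (F^[k] ρ) T ^ 2 ≤ C ^ 2 * infDist ρ T ^ 2 :=
      calc _ ≤ C ^ 2 * θ ^ (2 * k) * infDist ρ T ^ 2 := hsq k (mem_range.1 hk).le
        _ ≤ C ^ 2 * 1 * infDist ρ T ^ 2 := by gcongr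
        _ = _ := by ring
    calc φ (F^[k] ρ) ≤ C * (ε + infDist (F^[k] ρ) T ^ 2) := (hφ _).2
      _ ≤ C * ((1 + C ^ 2) * (ε + infDist ρ T ^ 2)) := by
          gcongr
          nlinarith [mul_nonneg (sq_nonneg C) hε.le]
      _ = _ := by ring
  have hupper : ∑ k ∈ range (K + 1), φ (F^[k] ρ) ≤
      (K + 1 : ℝ) * C * (1 + C ^ 2) * (ε + infDist ρ T ^ 2) := by
    refine (sum_le_card_nsmul _ _ _ hterm).trans_eq ?_
    rw [card_range, nsmul_eq_mul]
    push_cast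
    ring
  refine ⟨⟨hlower, hupper⟩, ?_⟩
  have htel : (∑ k ∈ range (K + 1), φ (F^[k] ρ)) - ∑ k ∈ range (K + 1), φ (F^[k] (F ρ)) =
      φ ρ - φ (F^[K + 1] ρ) := by
    rw [← sum_sub_distrib]
    exact sum_range_sub' (fun k => φ (F^[k] ρ)) (K + 1)
  have hlast : φ (F^[K + 1] ρ) ≤ C * ε + infDist ρ T ^ 2 / (2 * C) :=
    calc φ (F^[K + 1] ρ) ≤ C * (ε + infDist (F^[K + 1] ρ) T ^ 2) := (hφ _).2
      _ ≤ C * (ε + C ^ 2 * θ ^ (2 * (K + 1)) * infDist ρ T ^ 2) := by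
          gcongr
          exact hsq _ le_rfl
      _ = C * ε + C ^ 4 * θ ^ (2 * (K + 1)) * (infDist ρ T ^ 2 / C) := by
          field_simp
      _ ≤ C * ε + 1 / 2 * (infDist ρ T ^ 2 / C) := by gcongr
      _ = _ := by field_simp
  rw [htel, ge_iff_le]
  calc (∑ k ∈ range (K + 1), φ (F^[k] ρ)) / (2 * C ^ 2 * (K + 1 : ℝ) * (1 + C ^ 2))
      ≤ ((K + 1 : ℝ) * C * (1 + C ^ 2) * (ε + infDist ρ T ^ 2)) /
          (2 * C ^ 2 * (K + 1 : ℝ) * (1 + C ^ 2)) := by gcongr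
    _ = (ε + infDist ρ T ^ 2) / (2 * C) := by field_simp
    _ ≤ (1 / C) * (ε + infDist ρ T ^ 2) - infDist ρ T ^ 2 / (2 * C) := by
        have hεC : 0 ≤ ε / (2 * C) := by positivity
        have heq : (1 / C) * (ε + infDist ρ T ^ 2) - infDist ρ T ^ 2 / (2 * C) =
            (ε + infDist ρ T ^ 2) / (2 * C) + ε / (2 * C) := by
          field_simp
          ring
        linarith
    _ ≤ φ ρ - φ (F^[K + 1] ρ) + C * ε := by linarith [(hφ ρ).1]
end

section
/- For all constants C₀ > 0 and C₃ ≥ 1 there exist M ≥ 1 and C₁ ≥ 1 such that the following holds. Let (X,d) be a metric space, F : X → X a map, V ⊆ X, let T₊, T₋, T ⊆ X be nonempty subsets, let ε > 0, and let φ₊, φ₋ : X → ℝ satisfy: (i) (1/C₃)·(infDist(ρ,T_±)² + ε) ≤ φ_±(ρ) ≤ C₃·(infDist(ρ,T_±)² + ε) for all ρ ∈ V ∪ F(V); (ii) φ₊(ρ) − φ₊(F(ρ)) + C₀·ε ≥ φ₊(ρ)/C₃ and φ₋(F(ρ)) − φ₋(ρ) + C₀·ε ≥ φ₋(ρ)/C₃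 for all ρ ∈ V; (iii) infDist(ρ,T)² ≤ C₃·(infDist(ρ,T₊)² + infDist(ρ,T₋)²) for all ρ ∈ V. Define Ĝ(ρ) := log(M·ε + φ₋(ρ)) − log(M·ε + φ₊(ρ)). Then: (a) Ĝ(F(ρ)) − Ĝ(ρ) ≥ −4·C₀/M for all ρ ∈ V; and (b) Ĝ(F(ρ)) − Ĝ(ρ) ≥ 1/C₁ for every ρ ∈ V with infDist(ρ,T)² ≥ C₁·ε. -/
open Metric

theorem le_log_sub_log_of_le_mul {x y s : ℝ} (hx : 0 < x) (hy : 0 < y)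
    (h : x ≤ (1 - s) * y) : s ≤ Real.log y - Real.log x := by
  have h1 := Real.one_sub_inv_le_log_of_pos (div_pos hy hx)
  rw [Real.log_div hy.ne' hx.ne', inv_div] at h1
  have h2 : x / y ≤ 1 - s := (div_le_iff₀ hy).2 h
  linarith

/-- Regularization at scale `M * ε` bounds the logarithmic loss caused by an additive
error `C * ε`. -/
theorem neg_div_le_log_add_sub_log_add {C M ε u v : ℝ} (hC : 0 ≤ C) (hM : 0 < M)
    (hε : 0 < ε) (hu : 0 ≤ u) (hv : 0 ≤ v) (h : u ≤ v + C * ε) :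
    -(C / M) ≤ Real.log (M * ε + v) - Real.log (M * ε + u) := by
  have hMε : 0 < M * ε := mul_pos hM hε
  refine le_log_sub_log_of_le_mul (by linarith) (by linarith) ?_
  have h1 : C / M * (M * ε) = C * ε := by field_simp
  have h2 : 0 ≤ C / M * v := mul_nonneg (div_nonneg hC hM.le) hv
  linarith

/-- A proportional increase of a large quantity yields a definite logarithmic gain. -/
theorem div_five_le_log_add_sub_log_add_of_increase {c m e u v : ℝ} (hc : 0 < c)
    (hc1 : c ≤ 1) (hm : 0 < m) (hmu : m ≤ u) (he : 8 * e ≤ c * m)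
    (h : c * u ≤ v - u + e) :
    c / 5 ≤ Real.log (m + v) - Real.log (m + u) := by
  have h1 : c * m ≤ c * u := by gcongr
  have h2 : 0 < c * m := mul_pos hc hm
  have h3 : (1 + 7 / 16 * c) * (m + u) ≤ m + v := by linarith
  refine le_log_sub_log_of_le_mul (by linarith) (by linarith) ?_
  calc m + u ≤ (1 - c / 5) * (1 + 7 / 16 * c) * (m + u) :=
        le_mul_of_one_le_left (by linarith) (by nlinarith)
    _ = (1 - c / 5) * ((1 + 7 / 16 * c) * (m + u)) := by ring
    _ ≤ (1 - c / 5) * (m + v) := by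
        apply mul_le_mul_of_nonneg_left h3
        linarith

/-- A proportional decrease of a large quantity yields a definite logarithmic gain. -/
theorem div_five_le_log_add_sub_log_add_of_decrease {c m e u v : ℝ} (hc : 0 < c)
    (hm : 0 < m) (hu : 0 ≤ u) (hmv : m ≤ v) (he : 8 * e ≤ c * m)
    (h : c * v ≤ v - u + e) :
    c / 5 ≤ Real.log (m + v) - Real.log (m + u) := by
  have h1 : c * m ≤ c * v := by gcongr
  have h2 : 0 < c * m := mul_pos hc hm
  refine le_log_sub_log_of_le_mul (by linarith) (by linarith) ?_
  linarith

/-- Lemma 4.4 of the paper: given regularized functions `φ₊, φ₋` comparable to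
`ε + dist(·,T₊)²`, `ε + dist(·,T₋)²`, respectively decreasing/increasing by a
definite proportion under `F` up to `O(ε)`, and transversality of the tails, the
logarithmically flattened `Ĝ = log(Mε+φ₋) − log(Mε+φ₊)` increases by `1/C₁` under
`F` at distance `≥ √(C₁ε)` from `T`, and never decreases by more than `4C₀/M`. -/
theorem log_flattened_escape_function (C₀ C₃ : ℝ) (hC₀ : 0 < C₀) (hC₃ : 1 ≤ C₃) :
    ∃ M C₁ : ℝ, 1 ≤ M ∧ 1 ≤ C₁ ∧
      ∀ (X : Type) [MetricSpace X] (F : X → X) (V : Set X)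
        (Tp Tm T : Set X) (ε : ℝ) (φp φm : X → ℝ),
        Tp.Nonempty → Tm.Nonempty → T.Nonempty → 0 < ε →
        (∀ ρ ∈ V ∪ F '' V,
          (1 / C₃) * (infDist ρ Tp ^ 2 + ε) ≤ φp ρ ∧
          φp ρ ≤ C₃ * (infDist ρ Tp ^ 2 + ε) ∧
          (1 / C₃) * (infDist ρ Tm ^ 2 + ε) ≤ φm ρ ∧
          φm ρ ≤ C₃ * (infDist ρ Tm ^ 2 + ε)) →
        (∀ ρ ∈ V, φp ρ / C₃ ≤ φp ρ - φp (F ρ) + C₀ * ε ∧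
          φm ρ / C₃ ≤ φm (F ρ) - φm ρ + C₀ * ε) →
        (∀ ρ ∈ V, infDist ρ T ^ 2 ≤ C₃ * (infDist ρ Tp ^ 2 + infDist ρ Tm ^ 2)) →
        (∀ ρ ∈ V,
          (Real.log (M * ε + φm (F ρ)) - Real.log (M * ε + φp (F ρ))) -
              (Real.log (M * ε + φm ρ) - Real.log (M * ε + φp ρ)) ≥ -(4 * C₀) / M) ∧
        (∀ ρ ∈ V, C₁ * ε ≤ infDist ρ T ^ 2 →
          (Real.log (M * ε + φm (F ρ)) - Real.log (M * ε + φp (F ρ))) -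
              (Real.log (M * ε + φm ρ) - Real.log (M * ε + φp ρ)) ≥ 1 / C₁) := by
  set M : ℝ := 8 * C₀ * C₃ + 1 with hMdef
  have hC₃0 : 0 < C₃ := by linarith
  have hCC : 0 < C₀ * C₃ := mul_pos hC₀ hC₃0
  have hM1 : 1 ≤ M := by linarith
  have hM0 : 0 < M := by linarith
  have hCM : 0 < C₃ ^ 2 * M := by positivity
  refine ⟨M, 2 * (C₃ ^ 2 * M) + 20 * C₃, hM1, by linarith, ?_⟩
  intro X _ F V Tp Tm T ε φp φm _ _ _ hε hcomp hmono htrans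
  have hMε : 0 < M * ε := mul_pos hM0 hε
  have hpos : ∀ ρ ∈ V ∪ F '' V, 0 ≤ φp ρ ∧ 0 ≤ φm ρ := fun ρ hρ ↦
    ⟨le_trans (by positivity) (hcomp ρ hρ).1, le_trans (by positivity) (hcomp ρ hρ).2.2.1⟩
  have hloss : ∀ ρ ∈ V,
      -(C₀ / M) ≤ Real.log (M * ε + φp ρ) - Real.log (M * ε + φp (F ρ)) ∧
      -(C₀ / M) ≤ Real.log (M * ε + φm (F ρ)) - Real.log (M * ε + φm ρ) := by
    intro ρ hρ
    obtain ⟨hp, hm⟩ := hpos ρ (.inl hρ)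
    obtain ⟨hp', hm'⟩ := hpos (F ρ) (.inr ⟨ρ, hρ, rfl⟩)
    obtain ⟨hdp, hdm⟩ := hmono ρ hρ
    have h1 := div_nonneg hp hC₃0.le
    have h2 := div_nonneg hm hC₃0.le
    exact ⟨neg_div_le_log_add_sub_log_add hC₀.le hM0 hε hp' hp (by linarith),
      neg_div_le_log_add_sub_log_add hC₀.le hM0 hε hm hm' (by linarith)⟩
  refine ⟨fun ρ hρ ↦ ?_, fun ρ hρ hfar ↦ ?_⟩
  · obtain ⟨h1, h2⟩ := hloss ρ hρ
    have h3 : -(4 * C₀) / M = -(4 * (C₀ / M)) := by ring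
    have h4 : 0 < C₀ / M := div_pos hC₀ hM0
    linarith
  · obtain ⟨hlp, hlm⟩ := hloss ρ hρ
    obtain ⟨hp', -⟩ := hpos (F ρ) (.inr ⟨ρ, hρ, rfl⟩)
    obtain ⟨hdp, hdm⟩ := hmono ρ hρ
    obtain ⟨hcp, -, hcm, -⟩ := hcomp ρ (.inl hρ)
    have hT := htrans ρ hρ
    have hc : 0 < 1 / C₃ := by positivity
    have hc1 : 1 / C₃ ≤ 1 := (div_le_one hC₃0).2 hC₃
    have hCcM : 8 * C₀ ≤ 1 / C₃ * M := by
      rw [one_div, inv_mul_eq_div, le_div_iff₀ hC₃0]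
      linarith
    have he : 8 * (C₀ * ε) ≤ 1 / C₃ * (M * ε) := by
      have := mul_le_mul_of_nonneg_right hCcM hε.le
      linarith
    have hsmall : C₀ / M ≤ 1 / C₃ / 8 := by
      rw [div_le_iff₀ hM0]
      linarith
    have hgain : 1 / (2 * (C₃ ^ 2 * M) + 20 * C₃) ≤ 1 / C₃ / 20 := by
      rw [div_div]
      exact one_div_le_one_div_of_le (by positivity) (by linarith)
    have hlarge : ∀ {d φ : ℝ}, 1 / C₃ * (d ^ 2 + ε) ≤ φ → C₃ * (M * ε) ≤ d ^ 2 →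
        M * ε ≤ φ := by
      intro d φ h hd
      refine le_trans ?_ h
      rw [one_div, inv_mul_eq_div, le_div_iff₀ hC₃0]
      linarith
    have hsum : 2 * (C₃ * (M * ε)) ≤ infDist ρ Tp ^ 2 + infDist ρ Tm ^ 2 := by
      refine le_of_mul_le_mul_left ?_ hC₃0
      have := mul_pos hC₃0 hε
      linarith
    rcases le_total (C₃ * (M * ε)) (infDist ρ Tp ^ 2) with hd | hd
    · have := div_five_le_log_add_sub_log_add_of_decrease hc hMε hp' (hlarge hcp hd) he
        (by rwa [one_div, inv_mul_eq_div])
      linarith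
    · have := div_five_le_log_add_sub_log_add_of_increase hc hc1 hMε
        (hlarge hcm (by linarith)) he (by rwa [one_div, inv_mul_eq_div])
      linarith
end

section
/- Let A be a complex unital Banach algebra and let M, Π ∈ A satisfy Π·Π = Π, ‖M·(1−Π)‖ < 1 and ‖(1−Π)·M‖ < 1. Define E₋₊ := −(Π − Π·M·Π) + Σ_{k=1}^{∞} Π·M·((1−Π)·M)^k·Π, the series converging absolutely in norm. Then 1 − M is invertible in A if and only if E₋₊ is invertible in the corner algebra Π·A·Π, i.e. if and only if there exists e ∈ A with e = Π·e·Π and e·E₋₊ = E₋₊·e = Π. -/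
/-- For an idempotent `P` and an element `a` of the corner `P * A * P`, the element `1 - P - a`
is a unit iff `a` is invertible in the corner. -/
theorem isUnit_one_sub_idempotent_sub_iff {A : Type*} [Ring A] {P a : A}
    (hP : P * P = P) (hPa : P * a = a) (haP : a * P = a) :
    IsUnit (1 - P - a) ↔ ∃ e : A, e = P * e * P ∧ e * a = P ∧ a * e = P := by
  constructor
  · rintro ⟨u, hu⟩
    have hl : P * (1 - P - a) = -a := by rw [mul_sub, mul_sub, mul_one, hP, hPa]; abel
    have hr : (1 - P - a) * P = -a := by rw [sub_mul, sub_mul, one_mul, hP, haP]; abel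
    have hau : a * ↑u⁻¹ = -P := by
      rw [← neg_neg a, ← hl, ← hu, neg_mul, mul_assoc, u.mul_inv, mul_one]
    have hua : ↑u⁻¹ * a = -P := by
      rw [← neg_neg a, ← hr, ← hu, mul_neg, ← mul_assoc, u.inv_mul, one_mul]
    refine ⟨-(P * ↑u⁻¹ * P), ?_, ?_, ?_⟩
    · simp only [mul_neg, neg_mul, mul_assoc, hP]
      rw [← mul_assoc P P, hP]
    · rw [neg_mul, mul_assoc, hPa, mul_assoc, hua, mul_neg, hP, neg_neg]
    · rw [mul_neg, ← mul_assoc, ← mul_assoc, haP, hau, neg_mul, hP, neg_neg]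
  · rintro ⟨e, he, hea, hae⟩
    have hPe : P * e = e := by rw [he, ← mul_assoc, ← mul_assoc, hP]
    have heP : e * P = e := by rw [he, mul_assoc, hP]
    refine ⟨⟨1 - P - a, 1 - P - e, ?_, ?_⟩, rfl⟩
    · simp only [sub_mul, mul_sub, one_mul, mul_one, hP, hPe, haP, hae]
      abel
    · simp only [sub_mul, mul_sub, one_mul, mul_one, hP, hPa, heP, hea]
      abel

/-- Jacobson's lemma for units. -/
theorem isUnit_one_sub_mul_comm {A : Type*} [Ring A] (a b : A) :
    IsUnit (1 - a * b) ↔ IsUnit (1 - b * a) := by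
  simpa [spectrum.mem_iff, not_iff_not] using
    spectrum.unit_mem_mul_comm (R := ℤ) (a := a) (b := b) (r := 1)


/-- Abstract core of Theorem 5.4 of the paper combined with the Schur complement
principle (Proposition 5.1): if `P` is an idempotent in a complex unital Banach
algebra and `‖M(1−P)‖ < 1`, `‖(1−P)M‖ < 1`, then the series defining the effective
Hamiltonian `E₋₊ = −(P − PMP) + Σ_{k≥1} P·M·((1−P)M)^k·P` converges absolutely, and
`1 − M` is invertible iff `E₋₊` is invertible in the corner algebra `P·A·P`. -/
theorem grushin_effective_hamiltonian {A : Type*} [NormedRing A] [NormOneClass A]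
    [NormedAlgebra ℂ A] [CompleteSpace A]
    (M P : A) (hP : P * P = P)
    (h₁ : ‖M * (1 - P)‖ < 1) (h₂ : ‖(1 - P) * M‖ < 1) :
    Summable (fun k : ℕ => ‖P * M * ((1 - P) * M) ^ (k + 1) * P‖) ∧
    (IsUnit (1 - M) ↔
      ∃ e : A, e = P * e * P ∧
        e * (-(P - P * M * P) + ∑' k : ℕ, P * M * ((1 - P) * M) ^ (k + 1) * P) = P ∧
        (-(P - P * M * P) + ∑' k : ℕ, P * M * ((1 - P) * M) ^ (k + 1) * P) * e = P) := by
  set x := (1 - P) * M with hx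
  have hsum : Summable fun k : ℕ => ‖x ^ (k + 1)‖ :=
    (summable_nat_add_iff 1).2 <|
      (summable_geometric_of_lt_one (norm_nonneg x) h₂).of_nonneg_of_le
        (fun _ => norm_nonneg _) (norm_pow_le x)
  refine ⟨(hsum.mul_left ‖P * M‖ |>.mul_right ‖P‖).of_nonneg_of_le
    (fun _ => norm_nonneg _) fun k => (norm_mul_le _ _).trans <|
      mul_le_mul_of_nonneg_right (norm_mul_le _ _) (norm_nonneg _), ?_⟩
  set R := ∑' k : ℕ, x ^ k with hR
  have hxR : (1 - x) * R = 1 := mul_neg_geom_series x h₂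
  have hRx : R * (1 - x) = 1 := geom_series_mul_neg x h₂
  have hE : -(P - P * M * P) + ∑' k : ℕ, P * M * x ^ (k + 1) * P = P * M * R * P - P := by
    rw [(hsum.of_norm.mul_left (P * M)).tsum_mul_right, hsum.of_norm.tsum_mul_left,
      geom_series_succ x h₂, ← hR]
    noncomm_ring
  rw [hE, ← isUnit_one_sub_idempotent_sub_iff hP
    (by simp only [mul_sub, ← mul_assoc, hP]) (by simp only [sub_mul, mul_assoc, hP])]
  have hMR : (1 - M) * R = 1 - P * (M * R) := by
    conv_rhs => rw [← hxR, hx]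
    noncomm_ring
  have hRunit : IsUnit R := ⟨⟨R, 1 - x, hRx, hxR⟩, rfl⟩
  rw [← hRunit.unit.isUnit_mul_units, IsUnit.unit_spec, hMR]
  have hcorner : 1 - P - (P * M * R * P - P) = 1 - P * M * R * P := by abel
  rw [hcorner, isUnit_one_sub_mul_comm (P * M * R) P]
  simp only [← mul_assoc, hP]
end

section
/- Let R be a (possibly noncommutative) unital ring and let M, Π ∈ R satisfy Π·Π = Π and M·Π·M = M·M. Then, writing Q := 1 − Π, the following 2×2 matrix identity holds in the ring of 2×2 matrices over R: [[1−M, Π],[Π, 0]] · [[(1 + Q·M)·Q, Π + Q·M·Π],[Π·(1 + M·Q), −(Π − Π·M·Π)]] = [[1, 0],[0, Π]]. -/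
/-- Exact algebraic content of the well-posedness of the Grushin problem for
obstacle scattering (Theorem 6.9 of the paper): if `P` is an idempotent and
`M·P·M = M·M` (the exact version of eq. (6.40)), then, with `Q = 1 − P`, the
Grushin matrix for `1 − M` has the displayed exact right inverse. -/
theorem obstacle_grushin_identity {R : Type*} [Ring R] (M P : R)
    (hP : P * P = P) (hM : M * P * M = M * M) :
    (!![1 - M, P; P, 0] : Matrix (Fin 2) (Fin 2) R) *
        !![(1 + (1 - P) * M) * (1 - P), P + (1 - P) * M * P;
           P * (1 + M * (1 - P)), -(P - P * M * P)] =
      !![1, 0; 0, P] := by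
  have hP' (x : R) : P * (P * x) = P * x := by rw [← mul_assoc, hP]
  have hM' : M * (P * M) = M * M := by rw [← mul_assoc, hM]
  have hM'' (x : R) : M * (P * (M * x)) = M * (M * x) := by
    simp only [← mul_assoc, hM]
  rw [Matrix.mul_fin_two]
  simp only [mul_add, add_mul, mul_sub, sub_mul, mul_neg, mul_one, one_mul, zero_mul,
    mul_assoc, hP, hP', hM', hM'']
  ext i j
  fin_cases i <;> fin_cases j <;> (simp; try abel)
end

section
/- Let H be a complex Hilbert space and let P be a bounded self-adjoint operator on H with ‖P² − P‖ ≤ 1/16. Then there exists a bounded operator Q on H which is an orthogonal projection (Q² = Q and Q is self-adjoint) such that ‖Q − P‖ ≤ 2·‖P² − P‖. -/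
/-- A step function with its jump at `c` is continuous away from `c`. -/
theorem continuousOn_ite_lt_of_notMem {c : ℝ} {s : Set ℝ} (hc : c ∉ s) (a b : ℝ) :
    ContinuousOn (fun x : ℝ ↦ if x < c then a else b) s := by
  refine ContinuousOn.if (fun x hx ↦ ?_) continuousOn_const continuousOn_const
  have hxc : x = c := by simpa using frontier_lt_subset_eq continuous_id continuous_const hx.2
  exact absurd (hxc ▸ hx.1) hc

/-- A self-adjoint element `a` of a unital C⋆-algebra with `‖a * a - a‖ < 1 / 4` is within
`2 * ‖a * a - a‖` of a self-adjoint idempotent. -/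
theorem IsSelfAdjoint.exists_isIdempotent_norm_sub_le {A : Type*} [CStarAlgebra A] {a : A}
    (ha : IsSelfAdjoint a) (h : ‖a * a - a‖ < 1 / 4) :
    ∃ q : A, q * q = q ∧ IsSelfAdjoint q ∧ ‖q - a‖ ≤ 2 * ‖a * a - a‖ := by
  have hcfc : cfc (fun x : ℝ ↦ x * x - x) a = a * a - a := by
    rw [cfc_sub .., cfc_mul .., cfc_id' ℝ a]
  have hspec : ∀ x ∈ spectrum ℝ a, |x * x - x| ≤ ‖a * a - a‖ := fun x hx ↦ by
    simpa only [hcfc, Real.norm_eq_abs] using norm_apply_le_norm_cfc (fun x : ℝ ↦ x * x - x) a hx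
  have hhalf : (1 / 2 : ℝ) ∉ spectrum ℝ a := fun hx ↦ by
    have := (hspec _ hx).trans_lt h
    norm_num [abs_lt] at this
  have hf := continuousOn_ite_lt_of_notMem hhalf 0 1
  refine ⟨cfc (fun x : ℝ ↦ if x < 1 / 2 then 0 else 1) a, ?_, cfc_predicate _ a, ?_⟩
  · rw [← cfc_mul _ _ a hf hf]
    congr 1 with x
    split_ifs <;> simp
  · nth_rw 2 [← cfc_id' ℝ a]
    rw [← cfc_sub _ _ a hf (continuousOn_id' _)]
    refine norm_cfc_le (by positivity) fun x hx ↦ le_trans ?_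
      (mul_le_mul_of_nonneg_left (hspec x hx) zero_le_two)
    have hfactor : |x * x - x| = |x| * |x - 1| := by rw [← abs_mul]; ring_nf
    rw [Real.norm_eq_abs, hfactor]
    split_ifs with hlt
    · rw [zero_sub, abs_neg]
      nlinarith [abs_nonneg x, neg_le_abs (x - 1)]
    · rw [abs_sub_comm]
      nlinarith [abs_nonneg (x - 1), le_abs_self x]

/-- Lemma 6.7 of the paper: an approximate orthogonal projection (a bounded
self-adjoint `P` with `‖P² − P‖ ≤ 1/16`) on a complex Hilbert space is within
`2‖P² − P‖` of a genuine orthogonal projection. -/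
theorem approximate_projection {H : Type*} [NormedAddCommGroup H]
    [InnerProductSpace ℂ H] [CompleteSpace H]
    (P : H →L[ℂ] H) (hsa : IsSelfAdjoint P) (hP : ‖P * P - P‖ ≤ 1 / 16) :
    ∃ Q : H →L[ℂ] H, Q * Q = Q ∧ IsSelfAdjoint Q ∧ ‖Q - P‖ ≤ 2 * ‖P * P - P‖ := by
  exact hsa.exists_isIdempotent_norm_sub_le (hP.trans_lt (by norm_num))
end

section
/- Let N ≥ 1, let U ⊆ ℝ^N be open, and let F : U → ℝ^N be a smooth open embedding: F is infinitely differentiable on U, injective, its image F(U) is open, and the inverse map from F(U) to U is infinitely differentiable. Let K ⊆ U be compact and V ⊆ ℝ^N open, and assume: for every ρ ∈ K ∖ V there exists an integer n ≥ 1 such that F^[j](ρ) ∈ K for all 0 ≤ j < n and F^[n](ρ) ∉ K. Then there exists an infinitely differentiable function g : ℝ^N → ℝ with compact support and g ≥ 0 everywhere, such that g(F(ρ)) − g(ρ) ≥ 0 for every ρ ∈ K, and g(F(ρ)) − g(ρ) ≥ 1 for every ρ ∈ K ∖ V. -/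
open Set Topology in
/-- Transport of a bump function along an open embedding: a smooth nonnegative function with compact
support in `U` extends, after composition with the inverse of `F`, by zero. -/
theorem exists_contDiff_pushforward {E : Type*} [NormedAddCommGroup E] [NormedSpace ℝ E]
    {U : Set E} {F G : E → E} (hFc : ContinuousOn F U) (hFopen : IsOpen (F '' U))
    (hG : ContDiffOn ℝ (⊤ : ℕ∞) G (F '' U)) (hGF : ∀ x ∈ U, G (F x) = x)
    {φ : E → ℝ} (hφ : ContDiff ℝ (⊤ : ℕ∞) φ) (hφc : HasCompactSupport φ) (hφ0 : ∀ x, 0 ≤ φ x)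
    (hφU : tsupport φ ⊆ U) :
    ∃ ψ : E → ℝ, ContDiff ℝ (⊤ : ℕ∞) ψ ∧ HasCompactSupport ψ ∧ (∀ x, 0 ≤ ψ x) ∧
      tsupport ψ ⊆ F '' tsupport φ ∧ ∀ x ∈ U, ψ (F x) = φ x := by
  have hcomp : IsCompact (F '' tsupport φ) := hφc.isCompact.image_of_continuousOn (hFc.mono hφU)
  have hsub : Function.support ((F '' U).indicator (φ ∘ G)) ⊆ F '' tsupport φ := by
    intro y hy
    obtain ⟨⟨x, hx, rfl⟩, hne⟩ := indicator_apply_ne_zero.1 hy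
    simp only [Function.mem_support, Function.comp_apply, hGF x hx] at hne
    exact ⟨x, subset_tsupport φ hne, rfl⟩
  have htsub : tsupport ((F '' U).indicator (φ ∘ G)) ⊆ F '' tsupport φ :=
    closure_minimal hsub hcomp.isClosed
  refine ⟨(F '' U).indicator (φ ∘ G), contDiff_iff_contDiffAt.2 fun y => ?_,
    HasCompactSupport.of_support_subset_isCompact hcomp hsub,
    indicator_nonneg fun x _ => hφ0 _, htsub, fun x hx => ?_⟩
  · by_cases hy : y ∈ tsupport ((F '' U).indicator (φ ∘ G))
    swap
    · exact contDiffAt_const.congr_of_eventuallyEq (notMem_tsupport_iff_eventuallyEq.1 hy)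
    have hyU : F '' U ∈ 𝓝 y := hFopen.mem_nhds (image_mono hφU (htsub hy))
    refine ((hφ.contDiffAt (x := G y)).comp y (hG.contDiffAt hyU)).congr_of_eventuallyEq ?_
    filter_upwards [hyU] with z hz using indicator_of_mem hz _
  · rw [indicator_of_mem (mem_image_of_mem F hx), Function.comp_apply, hGF x hx]

open Set Topology in
/-- Near a point whose `n`-th iterate lies outside `K`, every bump function `φ` is, on `K`, a
coboundary `g ∘ F - g`. -/
theorem exists_nhds_forall_coboundary {E : Type*} [NormedAddCommGroup E] [NormedSpace ℝ E]
    {U : Set E} {F G : E → E} (hU : IsOpen U) (hFc : ContinuousOn F U) (hFopen : IsOpen (F '' U))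
    (hG : ContDiffOn ℝ (⊤ : ℕ∞) G (F '' U)) (hGF : ∀ x ∈ U, G (F x) = x)
    {K : Set E} (hK : IsClosed K) (hKU : K ⊆ U) (n : ℕ) (ρ : E)
    (hρU : ∀ j < n, F^[j] ρ ∈ U) (hρK : F^[n] ρ ∉ K) :
    ∃ W ∈ 𝓝 ρ, ∀ φ : E → ℝ, ContDiff ℝ (⊤ : ℕ∞) φ → HasCompactSupport φ → (∀ x, 0 ≤ φ x) →
      tsupport φ ⊆ W → ∃ g : E → ℝ, ContDiff ℝ (⊤ : ℕ∞) g ∧ HasCompactSupport g ∧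
        (∀ x, 0 ≤ g x) ∧ ∀ x ∈ K, g (F x) - g x = φ x := by
  induction n generalizing ρ with
  | zero =>
    refine ⟨Kᶜ, hK.isOpen_compl.mem_nhds hρK, fun φ _ _ _ hφK => ⟨0, contDiff_const,
      HasCompactSupport.zero, fun _ => le_rfl, fun x hx => ?_⟩⟩
    simp [image_eq_zero_of_notMem_tsupport fun h => hφK h hx]
  | succ n ih =>
    obtain ⟨W, hW, hcob⟩ := ih (F ρ) (fun j hj => hρU (j + 1) (by lia)) hρK
    have hUρ : U ∈ 𝓝 ρ := hU.mem_nhds (hρU 0 n.succ_pos)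
    refine ⟨U ∩ F ⁻¹' W, Filter.inter_mem hUρ (hFc.continuousAt hUρ hW),
      fun φ hφ hφc hφ0 hφW => ?_⟩
    obtain ⟨ψ, hψ, hψc, hψ0, hψsub, hψF⟩ := exists_contDiff_pushforward hFc hFopen hG hGF hφ hφc
      hφ0 (hφW.trans inter_subset_left)
    obtain ⟨h, hh, hhc, hh0, hhF⟩ := hcob ψ hψ hψc hψ0
      (hψsub.trans (image_subset_iff.2 (hφW.trans inter_subset_right)))
    refine ⟨h + ψ, hh.add hψ, hhc.add hψc, fun x => add_nonneg (hh0 x) (hψ0 x), fun x hx => ?_⟩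
    have := hhF x hx
    have := hψF x (hKU hx)
    simp only [Pi.add_apply]
    linarith


/-- Forward half of the escape-function construction of Lemma 4.5 (Appendix of
the paper): given a smooth open embedding `F` of an open set `U ⊆ ℝ^N`, a compact
`K ⊆ U` and an open `V` such that every point of `K ∖ V` escapes `K` in finite
time while staying in `K` beforehand, there is a smooth compactly supported
`g ≥ 0` with `g∘F − g ≥ 0` on `K` and `g∘F − g ≥ 1` on `K ∖ V`. -/
theorem forward_escape_function (N : ℕ) (hN : 1 ≤ N)
    (U : Set (EuclideanSpace ℝ (Fin N))) (hU : IsOpen U)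
    (F : EuclideanSpace ℝ (Fin N) → EuclideanSpace ℝ (Fin N))
    (hFsmooth : ContDiffOn ℝ (⊤ : ℕ∞) F U)
    (hFinj : Set.InjOn F U)
    (hFopen : IsOpen (F '' U))
    (hFinv : ∃ G : EuclideanSpace ℝ (Fin N) → EuclideanSpace ℝ (Fin N),
      ContDiffOn ℝ (⊤ : ℕ∞) G (F '' U) ∧ ∀ x ∈ U, G (F x) = x)
    (K : Set (EuclideanSpace ℝ (Fin N))) (hK : IsCompact K) (hKU : K ⊆ U)
    (V : Set (EuclideanSpace ℝ (Fin N))) (hV : IsOpen V)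
    (hesc : ∀ ρ ∈ K \ V, ∃ n : ℕ, 1 ≤ n ∧
      (∀ j < n, F^[j] ρ ∈ K) ∧ F^[n] ρ ∉ K) :
    ∃ g : EuclideanSpace ℝ (Fin N) → ℝ,
      ContDiff ℝ (⊤ : ℕ∞) g ∧ HasCompactSupport g ∧ (∀ x, 0 ≤ g x) ∧
      (∀ ρ ∈ K, 0 ≤ g (F ρ) - g ρ) ∧
      (∀ ρ ∈ K \ V, 1 ≤ g (F ρ) - g ρ) := by
  obtain ⟨G, hG, hGF⟩ := hFinv
  have key : ∀ ρ ∈ K \ V, ∃ S ∈ nhdsWithin ρ (K \ V), ∃ g : EuclideanSpace ℝ (Fin N) → ℝ,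
      ContDiff ℝ (⊤ : ℕ∞) g ∧ HasCompactSupport g ∧ (∀ x, 0 ≤ g x) ∧
      (∀ ρ ∈ K, 0 ≤ g (F ρ) - g ρ) ∧ (∀ ρ ∈ K ∩ S, 1 ≤ g (F ρ) - g ρ) := by
    intro ρ hρ
    obtain ⟨n, -, hin, hout⟩ := hesc ρ hρ
    obtain ⟨W, hW, hcob⟩ := exists_nhds_forall_coboundary hU hFsmooth.continuousOn hFopen hG hGF
      hK.isClosed hKU n ρ (fun j hj => hKU (hin j hj)) hout
    obtain ⟨χ, hχW, hχc, hχ, hχr, hχρ⟩ := exists_contDiff_tsupport_subset (n := (⊤ : ℕ∞)) hW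
    have hχ0 : ∀ x, 0 ≤ χ x := fun x => (hχr (Set.mem_range_self x)).1
    obtain ⟨g, hg, hgc, hg0, hgF⟩ := hcob (χ + χ) (hχ.add hχ) (hχc.add hχc)
      (fun x => add_nonneg (hχ0 x) (hχ0 x))
      ((tsupport_add χ χ).trans (Set.union_subset hχW hχW))
    refine ⟨{x | 1 < (χ + χ) x}, mem_nhdsWithin_of_mem_nhds <|
      (isOpen_lt continuous_const (hχ.add hχ).continuous).mem_nhds (by simp [hχρ]), g, hg, hgc, hg0,
      fun x hx => ?_, fun x hx => ?_⟩
    · rw [hgF x hx]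
      exact add_nonneg (hχ0 x) (hχ0 x)
    · rw [hgF x hx.1]
      exact hx.2.le
  have hmain := (hK.diff hV).induction_on (p := fun S => ∃ g : EuclideanSpace ℝ (Fin N) → ℝ,
      ContDiff ℝ (⊤ : ℕ∞) g ∧ HasCompactSupport g ∧ (∀ x, 0 ≤ g x) ∧
      (∀ ρ ∈ K, 0 ≤ g (F ρ) - g ρ) ∧ (∀ ρ ∈ K ∩ S, 1 ≤ g (F ρ) - g ρ))
    ⟨0, contDiff_const, HasCompactSupport.zero, by simp, by simp, by simp⟩
    (fun S T hST ⟨g, h1, h2, h3, h4, h5⟩ => ⟨g, h1, h2, h3, h4, fun x hx => h5 x ⟨hx.1, hST hx.2⟩⟩)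
    (fun S T ⟨g, h1, h2, h3, h4, h5⟩ ⟨g', h1', h2', h3', h4', h5'⟩ =>
      ⟨g + g', h1.add h1', h2.add h2', fun x => add_nonneg (h3 x) (h3' x), fun x hx => by
        have := h4 x hx
        have := h4' x hx
        simp only [Pi.add_apply]
        linarith, fun x hx => by
        have := h4 x hx.1
        have := h4' x hx.1
        simp only [Pi.add_apply]
        rcases hx.2 with h | h
        · linarith [h5 x ⟨hx.1, h⟩]
        · linarith [h5' x ⟨hx.1, h⟩]⟩)
    key
  obtain ⟨g, h1, h2, h3, h4, h5⟩ := hmain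
  exact ⟨g, h1, h2, h3, h4, fun x hx => h5 x ⟨hx.1, hx⟩⟩
end
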